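/- Let n ≥ 1 be an integer, let ζ ∈ ℂ be a primitive nth root of unity, let a ∈ ℂ with a^n ≠ 1, let ℓ ≥ 0 be an integer, and set q = ζ and L = ζ^ℓ. Writing Ψ(ℓ) = G(a,ζ;ℓ,ℓ)·F_n(1,ζ;ℓ,ℓ), one has −qL²(1+L)(1+4L+L²)(1−qL)³(1−La)²(1−qLa)²·Ψ(ℓ+2) + (1−qL²)·[1 + 5(1+q)L + (5+16q+5q²)L² + (1+q)(1−5q+q²)L³ − 2q(3+25q+3q²)L⁴ + q(1+q)(1−5q+q²)L⁵ + q²(5+16q+5q²)L⁶ + 5q³(1+q)L⁷ + q⁴L⁸]·(1−La)²(a−qL)²·Ψ(ℓ+1) − qL²(1−L)³(1+qL)(1+4qL+q²L²)(a−L)²(a−qL)²·Ψ(ℓ) = 0; that is, G(a,ζ;ℓ,ℓ)F_n(1,ζ;ℓ,ℓ) satisfies the same three-term recursion in ℓ as F_n(a,ζ;ℓ,ℓ). -/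

import Mathlib

open Finset

/-- The q-Pochhammer symbol `(x;q)_k = ∏_{j=0}^{k-1} (1 - x q^j)`. -/
noncomputable def qPoch (x q : ℂ) (k : ℕ) : ℂ := ∏ j ∈ Finset.range k, (1 - x * q ^ j)

/-- The summand `f_k(a,q;ℓ1,ℓ2)`. -/
noncomputable def f (a q : ℂ) (l1 l2 : ℤ) (k : ℕ) : ℂ :=
  qPoch (q ^ l1 * a) q k * qPoch (q ^ (1 - l1) * a) q k *
    qPoch (q ^ l2 * a) q k * qPoch (q ^ (1 - l2) * a) q k * q ^ k /
    (qPoch (q * a) q k) ^ 4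

/-- The truncated sum `F_n(a,q;ℓ1,ℓ2)`. -/
noncomputable def F (n : ℕ) (a q : ℂ) (l1 l2 : ℤ) : ℂ :=
  ∑ k ∈ Finset.range n, f a q l1 l2 k

/-- The product `G(a,q;ℓ1,ℓ2)`. -/
noncomputable def G (a q : ℂ) (l1 l2 : ℕ) : ℂ :=
  ((∏ j ∈ Finset.range l1, (a - q ^ j)) * ∏ j ∈ Finset.range l2, (a - q ^ j)) /
    ((∏ j ∈ Finset.range l1, (1 - q ^ j * a)) * ∏ j ∈ Finset.range l2, (1 - q ^ j * a))

lemma qPoch_succ (x q : ℂ) (k : ℕ) : qPoch x q (k + 1) = qPoch x q k * (1 - x * q ^ k) :=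
  Finset.prod_range_succ _ _

lemma qPoch_succ_left (x q : ℂ) (k : ℕ) :
    qPoch x q (k + 1) = (1 - x) * qPoch (q * x) q k := by
  simp only [qPoch, Finset.prod_range_succ', pow_zero, mul_one, pow_succ]
  rw [mul_comm]
  congr 1
  exact Finset.prod_congr rfl fun j _ => by ring

lemma qPoch_eq_zero {x q : ℂ} {j k : ℕ} (hj : j < k) (h : x * q ^ j = 1) : qPoch x q k = 0 :=
  Finset.prod_eq_zero (Finset.mem_range.2 hj) (by rw [h, sub_self])

lemma f_one_diag {q : ℂ} (hq : q ≠ 0) (m k : ℕ) :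
    f 1 q m m k = qPoch (q ^ m) q k ^ 2 * qPoch (q / q ^ m) q k ^ 2 * q ^ k /
      qPoch q q k ^ 4 := by
  simp only [f, mul_one, zpow_sub₀ hq, zpow_one, zpow_natCast]
  ring

/-- The coefficient of `F_n(1,q;ℓ+2,ℓ+2)` in the recursion, with `L = q ^ ℓ`. -/
noncomputable def recCoeffTwo (q L : ℂ) : ℂ :=
  -(q * L ^ 2 * (1 + L) * (1 + 4 * L + L ^ 2) * (1 - q * L) ^ 3)

/-- The coefficient of `F_n(1,q;ℓ+1,ℓ+1)` in the recursion, with `L = q ^ ℓ`. -/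
noncomputable def recCoeffOne (q L : ℂ) : ℂ :=
  (1 - q * L ^ 2) *
    (1 + 5 * (1 + q) * L + (5 + 16 * q + 5 * q ^ 2) * L ^ 2 +
      (1 + q) * (1 - 5 * q + q ^ 2) * L ^ 3 -
      2 * q * (3 + 25 * q + 3 * q ^ 2) * L ^ 4 +
      q * (1 + q) * (1 - 5 * q + q ^ 2) * L ^ 5 +
      q ^ 2 * (5 + 16 * q + 5 * q ^ 2) * L ^ 6 +
      5 * q ^ 3 * (1 + q) * L ^ 7 + q ^ 4 * L ^ 8)

/-- The coefficient of `F_n(1,q;ℓ,ℓ)` in the recursion, with `L = q ^ ℓ`. -/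
noncomputable def recCoeffZero (q L : ℂ) : ℂ :=
  -(q * L ^ 2 * (1 - L) ^ 3 * (1 + q * L) * (1 + 4 * q * L + q ^ 2 * L ^ 2))

/-- The polynomial part of the telescoping certificate, in the variable `x = q ^ k`. -/
noncomputable def certPoly (q L x : ℂ) : ℂ :=
  (1 - q * L ^ 2) * (1 + L) * (1 + q * L) *
    (-(q ^ 2 * L ^ 2 * (4 + (14 + 2 * q) * L + 4 * q * L ^ 2)) +
      (1 + 4 * (1 + q) * L + (1 + 13 * q + q ^ 2) * L ^ 2 + q * (1 + 13 * q + q ^ 2) * L ^ 4 +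
        4 * q ^ 2 * (1 + q) * L ^ 5 + q ^ 3 * L ^ 6) * x -
      L ^ 2 * (4 + (2 + 14 * q) * L + 4 * q * L ^ 2) * x ^ 2)

/-- The combination of summands occurring in the recursion, evaluated at index `k + 1`. -/
lemma rec_summand_succ {q : ℂ} (hq : q ≠ 0) (l k : ℕ) {L : ℂ} (hL : L = q ^ l)
    (hk : ∀ j < k + 1, 1 - q ^ (j + 1) ≠ 0) :
    recCoeffTwo q L * f 1 q (l + 2 : ℕ) (l + 2 : ℕ) (k + 1) +
        recCoeffOne q L * f 1 q (l + 1 : ℕ) (l + 1 : ℕ) (k + 1) +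
        recCoeffZero q L * f 1 q l l (k + 1) =
      qPoch (q * L) q (k + 1) ^ 2 * qPoch (1 / L) q (k + 1) ^ 2 / (q * qPoch q q (k + 1) ^ 4) *
          certPoly q L (q ^ (k + 2)) -
        qPoch (q * L) q k ^ 2 * qPoch (1 / L) q k ^ 2 / (q * qPoch q q k ^ 4) *
          certPoly q L (q ^ (k + 1)) := by
  have hL0 : L ≠ 0 := hL ▸ pow_ne_zero _ hq
  have e2 : q ^ (l + 2) = q ^ 2 * L := by rw [hL]; ring
  have e1 : q ^ (l + 1) = q * L := by rw [hL]; ring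
  have d2 : q / (q ^ 2 * L) = 1 / (q * L) := by field_simp
  have d1 : q / (q * L) = 1 / L := by field_simp
  have hd : qPoch q q k ≠ 0 := Finset.prod_ne_zero_iff.2 fun j hj => by
    simpa [pow_succ'] using hk j (by have := Finset.mem_range.1 hj; omega)
  have hd' : 1 - q * q ^ k ≠ 0 := by simpa [pow_succ'] using hk k (by omega)
  have u2 : (1 - q * L) * qPoch (q ^ 2 * L) q (k + 1) =
      qPoch (q * L) q k * (1 - q * L * q ^ k) * (1 - q * L * q ^ (k + 1)) := by
    rw [← qPoch_succ, ← qPoch_succ, qPoch_succ_left (q * L) q (k + 1)]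
    ring_nf
  have t2 : qPoch (1 / (q * L)) q (k + 1) = (1 - 1 / (q * L)) * qPoch (1 / L) q k := by
    rw [qPoch_succ_left, show q * (1 / (q * L)) = 1 / L by field_simp]
  have u0 : qPoch L q (k + 1) = (1 - L) * qPoch (q * L) q k := qPoch_succ_left _ _ _
  have t0 : (1 - 1 / L) * qPoch (q / L) q (k + 1) =
      qPoch (1 / L) q k * (1 - 1 / L * q ^ k) * (1 - 1 / L * q ^ (k + 1)) := by
    rw [← qPoch_succ, ← qPoch_succ, qPoch_succ_left (1 / L) q (k + 1), mul_one_div]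
  have t0' : (1 - L) * qPoch (q / L) q (k + 1) =
      -L * (qPoch (1 / L) q k * (1 - 1 / L * q ^ k) * (1 - 1 / L * q ^ (k + 1))) := by
    rw [← t0]; field_simp; ring
  rw [f_one_diag hq, f_one_diag hq, f_one_diag hq, e2, e1, ← hL, d2, d1, t2, u0,
    show recCoeffTwo q L = -(q * L ^ 2 * (1 + L) * (1 + 4 * L + L ^ 2) * (1 - q * L)) *
      (1 - q * L) ^ 2 by rw [recCoeffTwo]; ring,
    show recCoeffZero q L = -(q * L ^ 2 * (1 - L) * (1 + q * L) *
      (1 + 4 * q * L + q ^ 2 * L ^ 2)) * (1 - L) ^ 2 by rw [recCoeffZero]; ring]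
  have r2 : ∀ c D T : ℂ, c * (1 - q * L) ^ 2 *
      (qPoch (q ^ 2 * L) q (k + 1) ^ 2 * T * q ^ (k + 1) / D) =
      c * ((qPoch (q * L) q k * (1 - q * L * q ^ k) * (1 - q * L * q ^ (k + 1))) ^ 2 * T *
        q ^ (k + 1) / D) := fun c D T => by rw [← u2]; ring
  have r0 : ∀ c D T : ℂ, c * (1 - L) ^ 2 * (T * qPoch (q / L) q (k + 1) ^ 2 * q ^ (k + 1) / D) =
      c * (T * (-L * (qPoch (1 / L) q k * (1 - 1 / L * q ^ k) *
        (1 - 1 / L * q ^ (k + 1)))) ^ 2 * q ^ (k + 1) / D) := fun c D T => by rw [← t0']; ring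
  rw [r2, r0, qPoch_succ (q * L), qPoch_succ (1 / L), qPoch_succ q]
  simp only [recCoeffOne, certPoly, pow_succ q k, pow_succ q (k + 1)]
  generalize qPoch (q * L) q k = w at *
  generalize qPoch (1 / L) q k = v at *
  generalize qPoch q q k = d at *
  generalize q ^ k = y at *
  field_simp
  ring

/-- Telescoped form of the recursion for the partial sums `F_{k+1}(1,q;ℓ,ℓ)`. -/
lemma rec_partial_sum {q : ℂ} (hq : q ≠ 0) (l k : ℕ) {L : ℂ} (hL : L = q ^ l)
    (hk : ∀ j < k, 1 - q ^ (j + 1) ≠ 0) :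
    recCoeffTwo q L * F (k + 1) 1 q (l + 2 : ℕ) (l + 2 : ℕ) +
        recCoeffOne q L * F (k + 1) 1 q (l + 1 : ℕ) (l + 1 : ℕ) +
        recCoeffZero q L * F (k + 1) 1 q l l =
      qPoch (q * L) q k ^ 2 * qPoch (1 / L) q k ^ 2 / (q * qPoch q q k ^ 4) *
        certPoly q L (q ^ (k + 1)) := by
  induction k with
  | zero =>
    simp [F, f, qPoch, recCoeffTwo, recCoeffOne, recCoeffZero, certPoly]
    field_simp
    ring
  | succ k ih =>
    have h := rec_summand_succ hq l k hL hk
    have h' := ih fun j hj => hk j (by omega)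
    simp only [F, Finset.sum_range_succ _ (k + 1)] at h' ⊢
    linear_combination h + h'

lemma F_one_recursion {n : ℕ} (hn : 1 ≤ n) {q : ℂ} (hq : IsPrimitiveRoot q n) (l : ℕ) {L : ℂ}
    (hL : L = q ^ l) :
    recCoeffTwo q L * F n 1 q (l + 2 : ℕ) (l + 2 : ℕ) +
        recCoeffOne q L * F n 1 q (l + 1 : ℕ) (l + 1 : ℕ) +
        recCoeffZero q L * F n 1 q l l = 0 := by
  have hq0 : q ≠ 0 := hq.ne_zero (by omega)
  obtain ⟨k, rfl⟩ : ∃ k, n = k + 1 := ⟨n - 1, by omega⟩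
  rw [rec_partial_sum hq0 l k hL fun j hj =>
    sub_ne_zero.2 (hq.pow_ne_one_of_pos_of_lt (by omega) (by omega)).symm]
  have hmod : L = q ^ (l % (k + 1)) := by
    rw [hL, hq.eq_orderOf, pow_mod_orderOf]
  have hlt : l % (k + 1) < k + 1 := Nat.mod_lt _ (by omega)
  generalize l % (k + 1) = r at hmod hlt
  have hL0 : L ≠ 0 := hmod ▸ pow_ne_zero _ hq0
  rcases Nat.lt_or_ge r k with hr | hr
  · rw [qPoch_eq_zero (x := 1 / L) hr (by rw [← hmod]; field_simp)]
    simp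
  · obtain rfl : r = k := by omega
    have hqL : q * L = 1 := by rw [hmod, ← pow_succ', hq.pow_eq_one]
    rcases Nat.eq_zero_or_pos r with rfl | hr
    · have hL1 : L = 1 := by simpa using hmod
      have hq1 : q = 1 := by simpa [hL1] using hqL
      simp [certPoly, hL1, hq1]
    · rw [qPoch_eq_zero (x := q * L) hr (by simpa using hqL)]
      simp

lemma G_diag_succ {a q : ℂ} {m : ℕ} (h : 1 - q ^ m * a ≠ 0) :
    G a q (m + 1) (m + 1) * (1 - q ^ m * a) ^ 2 = G a q m m * (a - q ^ m) ^ 2 := by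
  simp only [G, Finset.prod_range_succ]
  generalize 1 - q ^ m * a = u at *
  field_simp

theorem stmt_11 (n : ℕ) (hn : 1 ≤ n) (ζ : ℂ) (hζ : IsPrimitiveRoot ζ n)
    (a : ℂ) (ha : a ^ n ≠ 1) (l : ℕ) (q L : ℂ) (hq : q = ζ) (hL : L = ζ ^ l)
    (Ψ : ℕ → ℂ) (hΨ : ∀ m : ℕ, Ψ m = G a ζ m m * F n 1 ζ m m) :
    -(q * L ^ 2 * (1 + L) * (1 + 4 * L + L ^ 2) * (1 - q * L) ^ 3 *
          (1 - L * a) ^ 2 * (1 - q * L * a) ^ 2) * Ψ (l + 2) +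
      (1 - q * L ^ 2) *
        (1 + 5 * (1 + q) * L + (5 + 16 * q + 5 * q ^ 2) * L ^ 2 +
          (1 + q) * (1 - 5 * q + q ^ 2) * L ^ 3 -
          2 * q * (3 + 25 * q + 3 * q ^ 2) * L ^ 4 +
          q * (1 + q) * (1 - 5 * q + q ^ 2) * L ^ 5 +
          q ^ 2 * (5 + 16 * q + 5 * q ^ 2) * L ^ 6 +
          5 * q ^ 3 * (1 + q) * L ^ 7 + q ^ 4 * L ^ 8) *
        (1 - L * a) ^ 2 * (a - q * L) ^ 2 * Ψ (l + 1) -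
      q * L ^ 2 * (1 - L) ^ 3 * (1 + q * L) * (1 + 4 * q * L + q ^ 2 * L ^ 2) *
        (a - L) ^ 2 * (a - q * L) ^ 2 * Ψ l = 0 := by
  subst hq
  have hne : ∀ j, 1 - q ^ j * a ≠ 0 := fun j h => ha <| by
    have h1 : (q ^ j * a) ^ n = 1 := by rw [← sub_eq_zero.1 h, one_pow]
    rwa [mul_pow, ← pow_mul, mul_comm j, pow_mul, hζ.pow_eq_one, one_pow, one_mul] at h1
  have h1 := G_diag_succ (hne l)
  have h2 := G_diag_succ (hne (l + 1))
  have hrec := F_one_recursion hn hζ l hL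
  rw [pow_succ' q l, ← hL] at h2
  rw [← hL] at h1
  rw [hΨ, hΨ, hΨ]
  generalize F n 1 q (l + 2 : ℕ) (l + 2 : ℕ) = F2 at *
  generalize F n 1 q (l + 1 : ℕ) (l + 1 : ℕ) = F1 at *
  linear_combination (norm := (simp only [recCoeffTwo, recCoeffOne, recCoeffZero]; ring))
    (G a q l l * (a - L) ^ 2 * (a - q * L) ^ 2) * hrec +
    recCoeffTwo q L * (1 - L * a) ^ 2 * F2 * h2 +
    (recCoeffTwo q L * F2 + recCoeffOne q L * F1) * (a - q * L) ^ 2 * h1
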